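/- (Hilbert–Burch, existence direction) Let I be an ideal of a commutative noetherian local ring (R, m) with pd_R(R/I) = 2. Then there exist n ≥ 1, a non-zerodivisor a ∈ R, and an (n+1) × n matrix A over R such that: (1) R/I has a free resolution 0 → Rⁿ →A R^{n+1} →B R → 0, where B is the 1 × (n+1) matrix whose i-th entry is (−1)^{i−1} a·det(A_i); (2) I = a·I_n(A); and (3) the ideal I_n(A) is perfect of grade 2. -/

import Mathlib

/-!
STATEMENT 13 (Hilbert–Burch, existence direction): if pd_R(R/I) = 2 over a
commutative noetherian local ring, then I = a·I_n(A) for a non-zerodivisor a and an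
(n+1) × n matrix A, R/I has a free resolution 0 → Rⁿ →A R^{n+1} →B R → 0 with
B_i = (−1)^{i−1} a det(A_i), and I_n(A) is perfect of grade 2.
-/

open CategoryTheory

/-- `Ext^i_R(M, N)` for `R`-modules `M`, `N`. -/
noncomputable def extMod (R : Type) [CommRing R] (M N : ModuleCat R) (i : ℕ) : ModuleCat R :=
  ((Ext R (ModuleCat R) i).obj (Opposite.op M)).obj N

/-- `pd_R M ≤ n`: `Ext^i_R(M, N) = 0` for every `N` and every `i > n`. -/
def pdLE (R : Type) [CommRing R] (M : ModuleCat R) (n : ℕ) : Prop :=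
  ∀ (N : ModuleCat R) (i : ℕ), n < i → Subsingleton (extMod R M N i)

/-- `pd_R M = n` (for `n ≥ 1`): `pd_R M ≤ n` but not `≤ n - 1`. -/
def pdEq (R : Type) [CommRing R] (M : ModuleCat R) (n : ℕ) : Prop :=
  pdLE R M n ∧ ∀ m : ℕ, m < n → ¬ pdLE R M m

/-- `grade_R I = g`, via `grade_R I = min {i | Ext^i_R(R/I, R) ≠ 0}`. -/
def gradeEq (R : Type) [CommRing R] (I : Ideal R) (g : ℕ) : Prop :=
  (∀ i : ℕ, i < g → Subsingleton (extMod R (ModuleCat.of R (R ⧸ I)) (ModuleCat.of R R) i)) ∧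
    Nontrivial (extMod R (ModuleCat.of R (R ⧸ I)) (ModuleCat.of R R) g)

/-- An ideal is perfect of grade `g` if `grade_R I = pd_R (R/I) = g`. -/
def IsPerfectOfGrade (R : Type) [CommRing R] (I : Ideal R) (g : ℕ) : Prop :=
  gradeEq R I g ∧ pdEq R (ModuleCat.of R (R ⧸ I)) g

/-- `I_n(A)`: the ideal of `n × n` minors of an `(n+1) × n` matrix `A`; these are the
determinants of the matrices `A_i` obtained by deleting the `i`-th row of `A`. -/
noncomputable def minorsIdeal {R : Type} [CommRing R] {n : ℕ}
    (A : Matrix (Fin (n + 1)) (Fin n) R) : Ideal R :=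
  Ideal.span (Set.range fun i : Fin (n + 1) => (A.submatrix i.succAbove id).det)

/-- The linear map `R^{n+1} → R` given by a row vector `b`. -/
noncomputable def rowMap {R : Type} [CommRing R] {n : ℕ} (b : Fin (n + 1) → R) :
    (Fin (n + 1) → R) →ₗ[R] R :=
  ∑ i, b i • LinearMap.proj i

theorem Matrix.exists_submatrix_det_ne_zero {K : Type*} [Field K] {m n : ℕ}
    (A : Matrix (Fin m) (Fin n) K) (hA : Function.Injective A.mulVec) :
    ∃ e : Fin n → Fin m, Function.Injective e ∧ (A.submatrix e id).det ≠ 0 := by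
  have hr : A.rank = n := by
    have hA' : Function.Injective A.mulVecLin := hA
    rw [Matrix.rank, LinearMap.finrank_range_of_inj hA', Module.finrank_fin_fun]
  obtain ⟨κ, a, ha, hs, hli⟩ := exists_linearIndependent' K A.row
  have : Finite κ := Finite.of_injective a ha
  have := Fintype.ofFinite κ
  have hc : Fintype.card κ = n := by
    rw [← finrank_span_eq_card hli, hs, ← Matrix.rank_eq_finrank_span_row, hr]
  let f := Fintype.equivFinOfCardEq hc
  refine ⟨a ∘ f.symm, ha.comp f.symm.injective, ?_⟩
  have h : LinearIndependent K (A.submatrix (a ∘ f.symm) id).row :=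
    hli.comp f.symm f.symm.injective
  rw [Matrix.linearIndependent_rows_iff_isUnit, Matrix.isUnit_iff_isUnit_det] at h
  exact h.ne_zero

theorem Matrix.exists_submatrix_det_ne_zero_of_isDomain {D : Type*} [CommRing D] [IsDomain D]
    {m n : ℕ} (A : Matrix (Fin m) (Fin n) D) (hA : Function.Injective A.mulVec) :
    ∃ e : Fin n → Fin m, Function.Injective e ∧ (A.submatrix e id).det ≠ 0 := by
  let K := FractionRing D
  have h : Function.Injective (A.map (algebraMap D K)).mulVec := by
    rw [Matrix.mulVec_injective_iff] at hA ⊢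
    rw [← LinearIndependent.iff_fractionRing D K]
    exact hA.map' (((Algebra.linearMap D K).compLeft (Fin m)))
      (LinearMap.ker_eq_bot.2 fun v w h => funext fun i =>
        IsFractionRing.injective D K (congrFun h i))
  obtain ⟨e, he, hd⟩ := Matrix.exists_submatrix_det_ne_zero _ h
  refine ⟨e, he, fun h0 => hd ?_⟩
  rw [Matrix.submatrix_map, ← RingHom.mapMatrix_apply, ← RingHom.map_det, h0, map_zero]

/-- A form of McCoy's theorem. -/
theorem Matrix.exists_prime_exists_submatrix_det_notMem {S : Type*} [CommRing S]
    [IsNoetherianRing S] {m n : ℕ} (A : Matrix (Fin m) (Fin n) S)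
    (hA : Function.Injective A.mulVec) {x : S} (hx : x ≠ 0) :
    ∃ P : Ideal S, P.IsPrime ∧ (∀ s, s * x = 0 → s ∈ P) ∧
      ∃ e : Fin n → Fin m, Function.Injective e ∧ (A.submatrix e id).det ∉ P := by
  obtain ⟨P, hP, hle⟩ := exists_le_isAssociatedPrime_of_isNoetherianRing S x hx
  obtain ⟨hprime, y, hy⟩ := isAssociatedPrime_iff.1 hP
  have hy (s : S) : s ∈ P ↔ s * y = 0 := by rw [hy]; simp [Submodule.mem_colon_singleton]
  refine ⟨P, hprime, fun s hs => hle (by simpa [Submodule.mem_colon_singleton] using hs), ?_⟩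
  have h : Function.Injective (A.map (Ideal.Quotient.mk P)).mulVec := by
    rw [← Matrix.coe_mulVecLin, injective_iff_map_eq_zero]
    intro v hv
    obtain ⟨w, rfl⟩ := (Ideal.Quotient.mk_surjective (I := P)).comp_left v
    have hw : A.mulVec (y • w) = A.mulVec 0 := by
      rw [Matrix.mulVec_smul, Matrix.mulVec_zero]
      ext i
      have := congrFun hv i
      change (A.map (Ideal.Quotient.mk P)).mulVec (Ideal.Quotient.mk P ∘ w) i = 0 at this
      rw [← RingHom.map_mulVec, Ideal.Quotient.eq_zero_iff_mem, hy] at this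
      simpa [mul_comm] using this
    ext i
    have := congrFun (hA hw) i
    simpa [Ideal.Quotient.eq_zero_iff_mem, hy, mul_comm] using this
  obtain ⟨e, he, hd⟩ := Matrix.exists_submatrix_det_ne_zero_of_isDomain _ h
  refine ⟨e, he, fun h0 => hd ?_⟩
  rw [Matrix.submatrix_map, ← RingHom.mapMatrix_apply, ← RingHom.map_det,
    Ideal.Quotient.eq_zero_iff_mem.2 h0]

theorem Matrix.eq_zero_of_mul_det_submatrix_succAbove {S : Type*} [CommRing S]
    [IsNoetherianRing S] {n : ℕ} (A : Matrix (Fin (n + 1)) (Fin n) S)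
    (hA : Function.Injective A.mulVec) {x : S}
    (hx : ∀ i : Fin (n + 1), x * (A.submatrix i.succAbove id).det = 0) : x = 0 := by
  by_contra h0
  obtain ⟨P, -, hP, e, he, hd⟩ := A.exists_prime_exists_submatrix_det_notMem hA h0
  obtain ⟨i, hi⟩ : ∃ i, ∀ j, e j ≠ i := by
    by_contra! h
    simpa using Fintype.card_le_of_surjective e h
  choose σ hσ using fun j => Fin.exists_succAbove_eq (hi j)
  have hinj : Function.Injective σ := fun a b hab => he (by rw [← hσ a, ← hσ b, hab])
  have hbij := Finite.injective_iff_bijective.1 hinj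
  have : A.submatrix e id =
      (A.submatrix i.succAbove id).submatrix (Equiv.ofBijective σ hbij) id := by
    ext j k
    simp [hσ]
  rw [this, Matrix.det_permute] at hd
  exact hd (P.mul_mem_left _ (hP _ (by rw [mul_comm, hx])))

theorem Matrix.det_smul_mulVec_eq_zero {R : Type*} [CommRing R] {m n : ℕ}
    (A : Matrix (Fin m) (Fin n) R) (e : Fin n → Fin m) (v : Fin n → R)
    (h : ∀ s, A.mulVec v (e s) = 0) : (A.submatrix e id).det • v = 0 := by
  have h' : (A.submatrix e id).mulVec v = 0 := funext h
  rw [← Matrix.one_mulVec v, ← Matrix.smul_mulVec, ← Matrix.adjugate_mul,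
    ← Matrix.mulVec_mulVec, h', Matrix.mulVec_zero]

/-- In an exact sequence `0 → Rⁿ → Rᵐ → R` whose last map is nonzero, `m = n + 1`. -/
theorem Matrix.eq_add_one_of_exact {R : Type*} [CommRing R] [IsNoetherianRing R] {m n : ℕ}
    {A : Matrix (Fin m) (Fin n) R} {b : Fin m → R} (hA : Function.Injective A.mulVec)
    (hex : Function.Exact A.mulVec (b ⬝ᵥ ·)) (hb : b ≠ 0) : m = n + 1 := by
  obtain ⟨i₀, hi₀⟩ := Function.ne_iff.1 hb
  obtain ⟨P, hP, hann, e, he, hd⟩ := A.exists_prime_exists_submatrix_det_notMem hA hi₀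
  by_contra hmn
  set δ := (A.submatrix e id).det with hδ
  have hcard : ((Finset.univ.image e)ᶜ).card ≠ 1 := by
    rw [Finset.card_compl, Finset.card_image_of_injective _ he]
    simp only [Fintype.card_fin, Finset.card_univ]
    lia
  have hout (j : Fin m) (hj : ∀ s, e s ≠ j) : δ * b j = 0 := by
    obtain ⟨k, hk, hkj⟩ : ∃ k, (∀ s, e s ≠ k) ∧ k ≠ j := by
      by_contra! h
      refine hcard (Finset.card_eq_one.2 ⟨j, ?_⟩)
      ext k
      simp only [Finset.mem_compl, Finset.mem_image, Finset.mem_univ, true_and,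
        Finset.mem_singleton, not_exists]
      exact ⟨h k, fun hk => hk ▸ hj⟩
    obtain ⟨v, hv⟩ := (hex (Pi.single k (b j) - Pi.single j (b k))).1 (by
      simp [dotProduct_sub, mul_comm])
    have h0 : δ • v = 0 := A.det_smul_mulVec_eq_zero e v fun s => by
      rw [hv]; simp [hj s, hk s]
    have := congrFun (congrArg A.mulVec h0) k
    rw [Matrix.mulVec_smul, hv] at this
    simpa [hkj] using this
  have hall (i : Fin m) : δ * δ * b i = 0 := by
    by_cases hi : ∀ s, e s ≠ i
    · rw [mul_assoc, hout i hi, mul_zero]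
    · push Not at hi
      obtain ⟨s, rfl⟩ := hi
      set w := A.mulVec ((A.submatrix e id).adjugate.mulVec (Pi.single s 1)) with hw
      have hwe (t : Fin n) : w (e t) = δ * (Pi.single s 1 : Fin n → R) t := by
        change (A.submatrix e id).mulVec _ t = _
        rw [Matrix.mulVec_mulVec, Matrix.mul_adjugate, Matrix.smul_mulVec, Matrix.one_mulVec]
        rfl
      have hbw : ∑ i, b i * w i = 0 := (hex w).2 ⟨_, rfl⟩
      have := congrArg (δ * ·) hbw
      simp only [Finset.mul_sum, mul_zero] at this
      rw [Finset.sum_eq_single (e s), hwe] at this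
      · simpa [mul_comm, mul_assoc, mul_left_comm] using this
      · intro i _ his
        by_cases hi : ∀ s, e s ≠ i
        · rw [← mul_assoc, hout i hi, zero_mul]
        · push Not at hi
          obtain ⟨t, rfl⟩ := hi
          rw [hwe, Pi.single_eq_of_ne (fun h => his (by rw [h]))]
          simp
      · simp
  rcases hP.mem_or_mem (hann _ (hall i₀)) with h | h <;> exact hd h

/-- The signed maximal minors of an `(n + 1) × n` matrix. -/
noncomputable def Matrix.signedMinors {R : Type*} [CommRing R] {n : ℕ}
    (A : Matrix (Fin (n + 1)) (Fin n) R) (i : Fin (n + 1)) : R :=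
  (-1) ^ (i : ℕ) * (A.submatrix i.succAbove id).det

theorem Matrix.signedMinors_vecMul {R : Type*} [CommRing R] {n : ℕ}
    (A : Matrix (Fin (n + 1)) (Fin n) R) : Matrix.vecMul A.signedMinors A = 0 := by
  ext k
  have h := Matrix.det_succ_column_zero (Matrix.of fun i =>
    (Fin.cons (A i k) (A i) : Fin (n + 1) → R))
  rw [Matrix.det_zero_of_column_eq (Fin.succ_ne_zero k).symm (by simp)] at h
  rw [Pi.zero_apply, h, Matrix.vecMul, dotProduct]
  refine Finset.sum_congr rfl fun i _ => ?_
  simp only [signedMinors, Matrix.of_apply, Fin.cons_zero]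
  rw [mul_right_comm]
  rfl

section

variable {R : Type*} [CommRing R] {n : ℕ} {A : Matrix (Fin (n + 1)) (Fin n) R}
  {b : Fin (n + 1) → R}

theorem Matrix.mul_comm_of_vecMul_eq_zero (hex : Function.Exact A.mulVec (b ⬝ᵥ ·))
    {u : Fin (n + 1) → R} (hu : Matrix.vecMul u A = 0) (i j : Fin (n + 1)) :
    b i * u j = b j * u i := by
  obtain ⟨v, hv⟩ := (hex (Pi.single j (b i) - Pi.single i (b j))).1 (by
      simp [dotProduct_sub, mul_comm])
  have h := Matrix.dotProduct_mulVec u A v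
  rw [hv, hu, zero_dotProduct, dotProduct_sub, dotProduct_single, dotProduct_single,
    sub_eq_zero] at h
  simpa [mul_comm] using h

theorem Matrix.eq_zero_of_mul_signedMinors [IsNoetherianRing R]
    (hA : Function.Injective A.mulVec) {x : R} (hx : ∀ i, x * A.signedMinors i = 0) : x = 0 := by
  refine A.eq_zero_of_mul_det_submatrix_succAbove hA fun i => ?_
  have := congrArg ((-1) ^ (i : ℕ) * ·) (hx i)
  simp only [signedMinors, mul_left_comm x, ← mul_assoc ((-1 : R) ^ (i : ℕ)), ← pow_add] at this
  simpa using this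

/-- The maximal minors of `A` have no common zero divisor modulo a non-zero-divisor. -/
theorem Matrix.dvd_of_dvd_mul_signedMinors [IsNoetherianRing R]
    (hA : Function.Injective A.mulVec) (hex : Function.Exact A.mulVec (b ⬝ᵥ ·))
    {δ : R} (hδ : δ ∈ nonZeroDivisors R) {x : R} (hx : ∀ i, δ ∣ x * A.signedMinors i) :
    δ ∣ x := by
  let π := Ideal.Quotient.mk (Ideal.span {δ})
  have hπ (y : R) : π y = 0 ↔ δ ∣ y := by
    rw [Ideal.Quotient.eq_zero_iff_mem, Ideal.mem_span_singleton]
  have h : Function.Injective (A.map π).mulVec := by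
    rw [← Matrix.coe_mulVecLin, injective_iff_map_eq_zero]
    intro v hv
    obtain ⟨v, rfl⟩ := Ideal.Quotient.mk_surjective.comp_left v
    have hdvd (i) : δ ∣ A.mulVec v i := by
      rw [← hπ, RingHom.map_mulVec]
      exact congrFun hv i
    choose w hw using hdvd
    have hw : A.mulVec v = δ • w := funext hw
    have hbw : b ⬝ᵥ w = 0 := by
      have := hex.apply_apply_eq_zero v
      rw [hw, dotProduct_smul, smul_eq_mul] at this
      exact (mem_nonZeroDivisors_iff.1 hδ).1 _ this
    obtain ⟨v', hv'⟩ := (hex w).1 hbw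
    rw [← hv', ← Matrix.mulVec_smul] at hw
    ext i
    change π (v i) = 0
    rw [hπ, hA hw]
    exact ⟨_, rfl⟩
  rw [← hπ]
  refine Matrix.eq_zero_of_mul_det_submatrix_succAbove _ h fun i => ?_
  rw [Matrix.submatrix_map, ← RingHom.mapMatrix_apply, ← RingHom.map_det, ← map_mul, hπ]
  have := (hx i).mul_left ((-1) ^ (i : ℕ))
  simp only [signedMinors, mul_left_comm x, ← mul_assoc ((-1 : R) ^ (i : ℕ)), ← pow_add] at this
  simpa using this

theorem Matrix.exists_eq_smul_signedMinors_of_mul_comm [IsNoetherianRing R]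
    (hA : Function.Injective A.mulVec) (hex : Function.Exact A.mulVec (b ⬝ᵥ ·))
    {u : Fin (n + 1) → R}
    (hu : ∀ i j, u i * A.signedMinors j = u j * A.signedMinors i) :
    ∃ c : R, u = c • A.signedMinors := by
  let J : Ideal R := Ideal.span (Set.range A.signedMinors)
  obtain ⟨δ, hδJ, hδ⟩ : ∃ δ ∈ J, δ ∈ nonZeroDivisors R := by
    by_contra! h
    have hlt := Ideal.bot_lt_annihilator_of_disjoint_nonZeroDivisors
      (Set.disjoint_left.2 h)
    obtain ⟨x, hx, hx0⟩ := SetLike.exists_of_lt hlt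
    refine hx0 (A.eq_zero_of_mul_signedMinors hA fun i => ?_)
    exact Submodule.mem_annihilator.1 hx _ (Ideal.subset_span ⟨i, rfl⟩)
  obtain ⟨c, hc⟩ := (Submodule.mem_span_range_iff_exists_fun R).1 hδJ
  have hβ (j) : δ * u j = (∑ i, c i * u i) * A.signedMinors j := by
    rw [← hc, Finset.sum_mul, Finset.sum_mul]
    refine Finset.sum_congr rfl fun i _ => ?_
    rw [smul_eq_mul, mul_assoc, mul_assoc, hu i j, mul_comm (u j)]
  obtain ⟨a, ha⟩ := Matrix.dvd_of_dvd_mul_signedMinors hA hex hδ fun i => ⟨_, (hβ i).symm⟩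
  refine ⟨a, funext fun j => sub_eq_zero.1 ((mem_nonZeroDivisors_iff.1 hδ).1 _ ?_)⟩
  rw [mul_sub, hβ, ha, Pi.smul_apply, smul_eq_mul]
  ring

theorem Matrix.exists_eq_smul_signedMinors_of_exact [IsNoetherianRing R]
    (hA : Function.Injective A.mulVec) (hex : Function.Exact A.mulVec (b ⬝ᵥ ·)) :
    ∃ a ∈ nonZeroDivisors R, b = a • A.signedMinors := by
  obtain ⟨a, rfl⟩ := Matrix.exists_eq_smul_signedMinors_of_mul_comm hA hex
    (Matrix.mul_comm_of_vecMul_eq_zero hex A.signedMinors_vecMul)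
  refine ⟨a, mem_nonZeroDivisors_iff_right.2 fun x hx => ?_, rfl⟩
  refine A.eq_zero_of_mul_signedMinors hA fun i => ?_
  obtain ⟨v, hv⟩ := (hex (Pi.single i x)).1 (by
    simp only [dotProduct_single, Pi.smul_apply, smul_eq_mul]
    rw [mul_right_comm, mul_comm a, hx, zero_mul])
  have h := Matrix.dotProduct_mulVec A.signedMinors A v
  rw [hv, Matrix.signedMinors_vecMul, zero_dotProduct, dotProduct_single] at h
  rwa [mul_comm]

/-- Exactness at the middle of the dual of `0 → Rⁿ → Rⁿ⁺¹ → R`. -/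
theorem Matrix.exists_eq_smul_signedMinors_of_vecMul_eq_zero [IsNoetherianRing R]
    (hA : Function.Injective A.mulVec) (hex : Function.Exact A.mulVec (A.signedMinors ⬝ᵥ ·))
    {u : Fin (n + 1) → R} (hu : Matrix.vecMul u A = 0) :
    ∃ c : R, u = c • A.signedMinors :=
  Matrix.exists_eq_smul_signedMinors_of_mul_comm hA hex fun i j => by
    rw [mul_comm, Matrix.mul_comm_of_vecMul_eq_zero hex hu, mul_comm]

end

theorem subsingleton_ext_one_iff {C : Type*} [Category C] [Abelian C] [HasExt C]
    {S : ShortComplex C} (hS : S.ShortExact) [Projective S.X₂] (Y : C) :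
    Subsingleton (Abelian.Ext S.X₃ Y 1) ↔ ∀ φ : S.X₁ ⟶ Y, ∃ ψ : S.X₂ ⟶ Y, S.f ≫ ψ = φ := by
  constructor
  · intro h φ
    obtain ⟨x, hx⟩ := Abelian.Ext.contravariant_sequence_exact₁ hS Y (Abelian.Ext.mk₀ φ)
      (add_zero 1) (Subsingleton.elim _ _)
    obtain ⟨ψ, rfl⟩ := Abelian.Ext.homEquiv₀.symm.surjective x
    exact ⟨ψ, Abelian.Ext.homEquiv₀.symm.injective (by simpa using hx)⟩
  · refine fun h => subsingleton_of_forall_eq 0 fun x => ?_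
    obtain ⟨y, rfl⟩ := Abelian.Ext.contravariant_sequence_exact₃ hS Y x
      (Abelian.Ext.eq_zero_of_projective _) (add_zero 1)
    obtain ⟨φ, rfl⟩ := Abelian.Ext.homEquiv₀.symm.surjective y
    obtain ⟨ψ, rfl⟩ := h φ
    simp [← Abelian.Ext.mk₀_comp_mk₀]

theorem subsingleton_ext_of_shortExact {C : Type*} [Category C] [Abelian C] [HasExt C]
    {S : ShortComplex C} (hS : S.ShortExact) [Projective S.X₂] (Y : C) (n : ℕ)
    (h : Subsingleton (Abelian.Ext S.X₃ Y (n + 2))) :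
    Subsingleton (Abelian.Ext S.X₁ Y (n + 1)) := by
  refine subsingleton_of_forall_eq 0 fun x => ?_
  obtain ⟨y, rfl⟩ := Abelian.Ext.contravariant_sequence_exact₁ hS Y x
    (show 1 + (n + 1) = n + 2 by lia) (Subsingleton.elim _ _)
  rw [Abelian.Ext.eq_zero_of_projective y, Abelian.Ext.comp_zero]

/-- The cokernel of a map from a power `ι → R` to a projective module `M` is projective if every
functional on that power factors through `M`. -/
theorem LinearMap.projective_of_forall_functional_extends {R M N ι : Type*} [CommRing R]
    [AddCommGroup M] [Module R M] [Module.Projective R M] [AddCommGroup N] [Module R N]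
    {f : (ι → R) →ₗ[R] M} {g : M →ₗ[R] N} (hfg : Function.Exact f g) (hg : Function.Surjective g)
    (h : ∀ φ : (ι → R) →ₗ[R] R, ∃ ψ : M →ₗ[R] R, ψ ∘ₗ f = φ) : Module.Projective R N := by
  choose ψ hψ using h
  have hr : ∃ l, l ∘ₗ f = LinearMap.id :=
    ⟨LinearMap.pi fun i => ψ (LinearMap.proj i),
      LinearMap.ext fun v => funext fun i => DFunLike.congr_fun (hψ (LinearMap.proj i)) v⟩
  have hs := hfg.split_tfae'.out 1 0
  obtain ⟨-, l, hl⟩ := hs.1 ⟨hg, hr⟩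
  exact Module.Projective.of_split l g hl

section

variable {R : Type} [CommRing R] (J : Ideal R)

theorem Ideal.hasProjectiveDimensionLT_quotient_iff (n : ℕ) :
    HasProjectiveDimensionLT (ModuleCat.of R (R ⧸ J)) (n + 2) ↔
      HasProjectiveDimensionLT (ModuleCat.of R J) (n + 1) := by
  have hS := LinearMap.shortExact_shortComplexKer (f := J.mkQ) J.mkQ_surjective
  have hp : Projective (ModuleCat.of R R) := (IsProjective.iff_projective R).1 inferInstance
  rw [hS.hasProjectiveDimensionLT_X₃_iff n hp]
  let e : LinearMap.ker J.mkQ ≃ₗ[R] J := LinearEquiv.ofEq _ _ J.ker_mkQ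
  exact ⟨fun _ => hasProjectiveDimensionLT_of_iso e.toModuleIso _,
    fun _ => hasProjectiveDimensionLT_of_iso e.symm.toModuleIso _⟩

theorem Ideal.subsingleton_hom_quotient (h : ∀ x : R, (∀ y ∈ J, x * y = 0) → x = 0) :
    Subsingleton (ModuleCat.of R (R ⧸ J) ⟶ ModuleCat.of R R) := by
  refine subsingleton_of_forall_eq 0 fun f => ModuleCat.hom_ext (LinearMap.ext fun z => ?_)
  obtain ⟨z, rfl⟩ := Ideal.Quotient.mk_surjective z
  refine h _ fun y hy => ?_
  rw [mul_comm, ← smul_eq_mul, ← map_smul]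
  have : y • Ideal.Quotient.mk J z = 0 := by
    rw [← Ideal.Quotient.mk_eq_mk, ← Submodule.Quotient.mk_smul, Submodule.Quotient.mk_eq_zero]
    exact J.mul_mem_right _ hy
  rw [this, map_zero]

theorem Ideal.subsingleton_ext_one_quotient
    (h : ∀ φ : J →ₗ[R] R, ∃ c : R, ∀ y : J, φ y = c * y) :
    Subsingleton (Abelian.Ext (ModuleCat.of R (R ⧸ J)) (ModuleCat.of R R) 1) := by
  have hS := LinearMap.shortExact_shortComplexKer (f := J.mkQ) J.mkQ_surjective
  have hp : Projective J.mkQ.shortComplexKer.X₂ :=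
    (IsProjective.iff_projective R).1 inferInstance
  refine (subsingleton_ext_one_iff hS _).2 fun φ => ?_
  let e : LinearMap.ker J.mkQ ≃ₗ[R] J := LinearEquiv.ofEq _ _ J.ker_mkQ
  obtain ⟨c, hc⟩ := h (φ.hom ∘ₗ e.symm.toLinearMap)
  refine ⟨ModuleCat.ofHom (LinearMap.lsmul R R c), ModuleCat.hom_ext (LinearMap.ext fun z => ?_)⟩
  exact (hc (e z)).symm

theorem Ideal.nontrivial_ext_two_quotient {m n : ℕ} {f : (Fin n → R) →ₗ[R] (Fin m → R)}
    {g : (Fin m → R) →ₗ[R] J} (hf : Function.Injective f)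
    (hfg : Function.Exact f g) (hg : Function.Surjective g) (hJ : ¬ Module.Projective R J) :
    Nontrivial (Abelian.Ext (ModuleCat.of R (R ⧸ J)) (ModuleCat.of R R) 2) := by
  by_contra h
  rw [not_nontrivial_iff_subsingleton] at h
  refine hJ (LinearMap.projective_of_forall_functional_extends hfg hg ?_)
  have hS := LinearMap.shortExact_shortComplexKer (f := J.mkQ) J.mkQ_surjective
  have hp : Projective J.mkQ.shortComplexKer.X₂ :=
    (IsProjective.iff_projective R).1 inferInstance
  have h1 := subsingleton_ext_of_shortExact hS (ModuleCat.of R R) 0 h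
  let e : J ≃ₗ[R] LinearMap.ker J.mkQ := LinearEquiv.ofEq _ _ J.ker_mkQ.symm
  let T : ShortComplex (ModuleCat R) := ShortComplex.mk (ModuleCat.ofHom f)
    (ModuleCat.ofHom (e.toLinearMap ∘ₗ g)) (by
      ext1
      refine LinearMap.ext fun v => ?_
      simp [hfg.apply_apply_eq_zero])
  have hT : T.ShortExact :=
    { exact := by
        rw [ShortComplex.moduleCat_exact_iff]
        intro x hx
        exact (hfg x).1 (e.injective (hx.trans e.map_zero.symm))
      mono_f := (ModuleCat.mono_iff_injective _).2 hf
      epi_g := (ModuleCat.epi_iff_surjective _).2 (e.surjective.comp hg) }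
  have hp' : Projective T.X₂ := (IsProjective.iff_projective _).1 inferInstance
  intro φ
  obtain ⟨ψ, hψ⟩ := (subsingleton_ext_one_iff hT _).1 h1 (ModuleCat.ofHom φ)
  exact ⟨ψ.hom, congrArg ModuleCat.Hom.hom hψ⟩

end

theorem subsingleton_extMod_iff {R : Type} [CommRing R] {M N : ModuleCat R}
    (P : ProjectiveResolution M) (i : ℕ) :
    Subsingleton (extMod R M N i) ↔ (P.complex.linearYonedaObj R N).ExactAt i := by
  rw [HomologicalComplex.exactAt_iff_isZero_homology, ModuleCat.isZero_iff_subsingleton]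
  exact (P.isoExt i N).toLinearEquiv.toEquiv.subsingleton_congr

theorem subsingleton_extMod_zero {R : Type} [CommRing R] {M N : ModuleCat R}
    (h : Subsingleton (M ⟶ N)) : Subsingleton (extMod R M N 0) := by
  have P := projectiveResolution M
  rw [subsingleton_extMod_iff P, HomologicalComplex.exactAt_iff' _ 0 0 1 (by simp)
    (by simp), ShortComplex.moduleCat_exact_iff]
  intro f hf
  refine ⟨0, ?_⟩
  have h0 : P.exact₀.desc f hf = 0 := Subsingleton.elim (α := M ⟶ N) _ _
  rw [map_zero, ← P.exact₀.g_desc f hf, h0, Limits.comp_zero]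
  rfl

theorem subsingleton_extMod_succ_iff {R : Type} [CommRing R] (M N : ModuleCat R) (i : ℕ) :
    Subsingleton (extMod R M N (i + 1)) ↔ Subsingleton (Abelian.Ext M N (i + 1)) := by
  have P := projectiveResolution M
  rw [subsingleton_extMod_iff P, HomologicalComplex.exactAt_iff' _ i (i + 1) (i + 2) (by simp)
    (by simp), ShortComplex.moduleCat_exact_iff]
  constructor
  · refine fun h => subsingleton_of_forall_eq 0 fun x => ?_
    obtain ⟨f, hf, rfl⟩ := P.extMk_surjective x (i + 2) rfl
    rw [P.extMk_eq_zero_iff f (i + 2) rfl hf i rfl]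
    exact h f hf
  · intro h f hf
    exact (P.extMk_eq_zero_iff f (i + 2) rfl hf i rfl).1 (Subsingleton.elim _ _)

theorem pdLE_iff {R : Type} [CommRing R] (M : ModuleCat R) (n : ℕ) :
    pdLE R M n ↔ HasProjectiveDimensionLT M (n + 1) := by
  rw [hasProjectiveDimensionLT_iff]
  constructor
  · intro h i hi Y e
    obtain ⟨i, rfl⟩ : ∃ j, i = j + 1 := ⟨i - 1, by lia⟩
    have := (subsingleton_extMod_succ_iff M Y i).1 (h Y _ hi)
    exact Subsingleton.elim _ _
  · intro h N i hi
    obtain ⟨i, rfl⟩ : ∃ j, i = j + 1 := ⟨i - 1, by lia⟩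
    rw [subsingleton_extMod_succ_iff]
    exact subsingleton_of_forall_eq 0 fun x => h _ hi x

theorem LinearMap.apply_eq_dotProduct {R : Type*} [CommRing R] {m : ℕ}
    (f : (Fin m → R) →ₗ[R] R) (w : Fin m → R) : f w = (fun i => f (Pi.single i 1)) ⬝ᵥ w := by
  rw [LinearMap.pi_apply_eq_sum_univ f w, dotProduct]
  refine Finset.sum_congr rfl fun i _ => ?_
  rw [smul_eq_mul, mul_comm]
  congr 2
  ext j
  simp [Pi.single_apply, eq_comm]

theorem rowMap_apply {R : Type} [CommRing R] {n : ℕ} (b w : Fin (n + 1) → R) :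
    rowMap b w = b ⬝ᵥ w := by
  simp [rowMap, dotProduct]

theorem range_rowMap {R : Type} [CommRing R] {n : ℕ} (b : Fin (n + 1) → R) :
    LinearMap.range (rowMap b) = Ideal.span (Set.range b) := by
  ext x
  rw [Ideal.span, Submodule.mem_span_range_iff_exists_fun]
  simp [rowMap_apply, dotProduct, mul_comm]

theorem Ideal.exists_presentation_of_hasProjectiveDimensionLT_two {R : Type} [CommRing R]
    [IsNoetherianRing R] [IsLocalRing R] {I : Ideal R}
    (hI : HasProjectiveDimensionLT (ModuleCat.of R I) 2) :
    ∃ (m n : ℕ) (A : Matrix (Fin m) (Fin n) R) (b : Fin m → R),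
      Function.Injective A.mulVec ∧ Function.Exact A.mulVec (b ⬝ᵥ ·) ∧
        Ideal.span (Set.range b) = I := by
  obtain ⟨m, g, hg⟩ := Module.Finite.exists_fin' R I
  have hp : Projective g.shortComplexKer.X₂ := (IsProjective.iff_projective _).1 inferInstance
  have hK : Module.Projective R (LinearMap.ker g) := by
    rw [IsProjective.iff_projective, projective_iff_hasProjectiveDimensionLT_one]
    exact ((LinearMap.shortExact_shortComplexKer hg).hasProjectiveDimensionLT_X₃_iff 0 hp).1 hI
  have hfree : Module.Free R (LinearMap.ker g) := Module.free_of_flat_of_isLocalRing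
  let e := (Module.finBasis R (LinearMap.ker g)).equivFun
  let f := (LinearMap.ker g).subtype ∘ₗ e.symm.toLinearMap
  have hA (v) : (LinearMap.toMatrix' f).mulVec v = f v := by
    rw [← Matrix.toLin'_apply, Matrix.toLin'_toMatrix']
  have hb (w) : (fun i => (g (Pi.single i 1) : R)) ⬝ᵥ w = g w :=
    (LinearMap.apply_eq_dotProduct (I.subtype ∘ₗ g) w).symm
  refine ⟨m, _, LinearMap.toMatrix' f, fun i => g (Pi.single i 1), ?_, ?_, ?_⟩
  · rw [funext hA]
    exact Subtype.val_injective.comp e.symm.injective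
  · intro w
    refine (Eq.congr_left (hb w)).trans ?_
    rw [funext hA]
    constructor
    · intro h
      exact ⟨e ⟨w, Subtype.ext h⟩, by simp [f]⟩
    · rintro ⟨v, rfl⟩
      exact congrArg Subtype.val (e.symm v).2
  · ext x
    rw [Ideal.span, Submodule.mem_span_range_iff_exists_fun]
    constructor
    · rintro ⟨c, rfl⟩
      exact I.sum_mem fun i _ => I.mul_mem_left _ (g _).2
    · intro hx
      obtain ⟨w, hw⟩ := hg ⟨x, hx⟩
      refine ⟨w, ?_⟩
      have := hb w
      rw [hw] at this
      simpa [dotProduct, mul_comm] using this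

theorem span_range_signedMinors {R : Type} [CommRing R] {n : ℕ}
    (A : Matrix (Fin (n + 1)) (Fin n) R) :
    Ideal.span (Set.range A.signedMinors) = minorsIdeal A := by
  refine le_antisymm (Ideal.span_le.2 ?_) (Ideal.span_le.2 ?_)
  · rintro _ ⟨i, rfl⟩
    exact Ideal.mul_mem_left _ _ (Ideal.subset_span ⟨i, rfl⟩)
  · rintro _ ⟨i, rfl⟩
    have h : (A.submatrix i.succAbove id).det = (-1) ^ (i : ℕ) * A.signedMinors i := by
      rw [Matrix.signedMinors, ← mul_assoc, ← mul_pow]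
      simp
    change (A.submatrix i.succAbove id).det ∈ _
    rw [h]
    exact Ideal.mul_mem_left _ _ (Ideal.subset_span ⟨i, rfl⟩)

theorem gradeEq_minorsIdeal_two {R : Type} [CommRing R] [IsNoetherianRing R] {n : ℕ}
    {A : Matrix (Fin (n + 1)) (Fin n) R} (hA : Function.Injective A.mulVec)
    (hex : Function.Exact A.mulVec (A.signedMinors ⬝ᵥ ·))
    (hJ : ¬ Module.Projective R (minorsIdeal A)) : gradeEq R (minorsIdeal A) 2 := by
  have hrange : LinearMap.range (rowMap A.signedMinors) = minorsIdeal A := by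
    rw [range_rowMap, span_range_signedMinors]
  have hmem (w) : rowMap A.signedMinors w ∈ minorsIdeal A := hrange ▸ ⟨w, rfl⟩
  let g := (rowMap A.signedMinors).codRestrict (minorsIdeal A) hmem
  have hg : Function.Surjective g := fun y => by
    obtain ⟨w, hw⟩ := hrange.ge y.2
    exact ⟨w, Subtype.ext hw⟩
  have hfg : Function.Exact A.mulVecLin g := fun w =>
    Subtype.ext_iff.trans ((Eq.congr_left (rowMap_apply A.signedMinors w)).trans (hex w))
  refine ⟨fun i hi => ?_, ?_⟩
  · obtain rfl | rfl : i = 0 ∨ i = 1 := by lia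
    · refine subsingleton_extMod_zero (Ideal.subsingleton_hom_quotient _ fun x hx => ?_)
      refine Matrix.eq_zero_of_mul_signedMinors hA fun i => hx _ ?_
      rw [← span_range_signedMinors]
      exact Ideal.subset_span ⟨i, rfl⟩
    · refine (subsingleton_extMod_succ_iff _ _ 0).2
        (Ideal.subsingleton_ext_one_quotient _ fun φ => ?_)
      let u : Fin (n + 1) → R := fun i => φ (g (Pi.single i 1))
      have hφ (w) : φ (g w) = u ⬝ᵥ w := LinearMap.apply_eq_dotProduct (φ ∘ₗ g) w
      obtain ⟨c, hc⟩ := Matrix.exists_eq_smul_signedMinors_of_vecMul_eq_zero hA hex (u := u) (by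
        ext k
        have h := hφ (A.mulVecLin (Pi.single k 1))
        rw [hfg.apply_apply_eq_zero, map_zero, Matrix.mulVecLin_apply,
          Matrix.dotProduct_mulVec, dotProduct_single, mul_one] at h
        exact h.symm)
      refine ⟨c, fun y => ?_⟩
      obtain ⟨w, rfl⟩ := hg y
      rw [hφ, hc, smul_dotProduct, smul_eq_mul, ← rowMap_apply]
      rfl
  · rw [← not_subsingleton_iff_nontrivial, subsingleton_extMod_succ_iff,
      not_subsingleton_iff_nontrivial]
    exact Ideal.nontrivial_ext_two_quotient _ (f := A.mulVecLin) hA hfg hg hJ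

theorem pdEq_quotient_two_iff {R : Type} [CommRing R] (J : Ideal R) :
    pdEq R (ModuleCat.of R (R ⧸ J)) 2 ↔
      HasProjectiveDimensionLT (ModuleCat.of R J) 2 ∧ ¬ Module.Projective R J := by
  rw [IsProjective.iff_projective, projective_iff_hasProjectiveDimensionLT_one,
    ← J.hasProjectiveDimensionLT_quotient_iff 0, ← J.hasProjectiveDimensionLT_quotient_iff 1,
    ← pdLE_iff, ← pdLE_iff]
  refine ⟨fun h => ⟨h.1, h.2 1 (by lia)⟩, fun h => ⟨h.1, fun m hm h' => h.2 fun N i hi => ?_⟩⟩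
  exact h' N i (by lia)

theorem hilbert_burch_existence
    (R : Type) [CommRing R] [IsNoetherianRing R] [IsLocalRing R]
    (I : Ideal R) (hpd : pdEq R (ModuleCat.of R (R ⧸ I)) 2) :
    ∃ (n : ℕ), 1 ≤ n ∧ ∃ (a : R) (A : Matrix (Fin (n + 1)) (Fin n) R),
      a ∈ nonZeroDivisors R ∧
      -- (1) 0 → Rⁿ →A R^{n+1} →B R → 0 is a free resolution of R/I, where the i-th
      -- entry of B is (−1)^{i−1}·a·det(A_i) (one-based indexing; here i is zero-based)
      (Function.Injective (Matrix.mulVecLin A) ∧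
        LinearMap.range (Matrix.mulVecLin A) =
          LinearMap.ker (rowMap fun i => (-1 : R) ^ (i : ℕ) * a *
            (A.submatrix i.succAbove id).det) ∧
        LinearMap.range (rowMap fun i => (-1 : R) ^ (i : ℕ) * a *
            (A.submatrix i.succAbove id).det) = I) ∧
      -- (2) I = a · I_n(A)
      I = Ideal.span {a} * minorsIdeal A ∧
      -- (3) I_n(A) is perfect of grade 2
      IsPerfectOfGrade R (minorsIdeal A) 2 := by
  rw [pdEq_quotient_two_iff] at hpd
  obtain ⟨hI, hIproj⟩ := hpd
  obtain ⟨m, n, A, b, hA, hex, hspan⟩ :=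
    Ideal.exists_presentation_of_hasProjectiveDimensionLT_two hI
  have hb : b ≠ 0 := by
    rintro rfl
    refine hIproj ?_
    have : I = ⊥ := by
      rw [← hspan, Ideal.span_eq_bot]
      rintro _ ⟨i, rfl⟩
      rfl
    subst this
    infer_instance
  obtain rfl := Matrix.eq_add_one_of_exact hA hex hb
  obtain ⟨a, ha, rfl⟩ := Matrix.exists_eq_smul_signedMinors_of_exact hA hex
  have hexJ : Function.Exact A.mulVec (A.signedMinors ⬝ᵥ ·) := fun w => by
    rw [← hex w]
    simp only [smul_dotProduct, smul_eq_mul]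
    exact ⟨fun h => by rw [h, mul_zero], (mem_nonZeroDivisors_iff.1 ha).1 _⟩
  have hmap : Submodule.map (LinearMap.lsmul R R a) (minorsIdeal A) = I := by
    rw [← hspan, ← span_range_signedMinors, Ideal.span, Submodule.map_span, ← Set.range_comp]
    rfl
  let e : minorsIdeal A ≃ₗ[R] I :=
    (Submodule.equivMapOfInjective (LinearMap.lsmul R R a)
      (fun x y h => (mul_cancel_left_mem_nonZeroDivisors ha).1 h) _).trans
      (LinearEquiv.ofEq _ _ hmap)
  have hJproj : ¬ Module.Projective R (minorsIdeal A) := fun h => hIproj (.of_equiv e)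
  have hJ : HasProjectiveDimensionLT (ModuleCat.of R (minorsIdeal A)) 2 :=
    hasProjectiveDimensionLT_of_iso e.symm.toModuleIso 2
  have hrow : (fun i : Fin (n + 1) => (-1 : R) ^ (i : ℕ) * a *
      (A.submatrix i.succAbove id).det) = a • A.signedMinors := by
    ext i
    simp only [Matrix.signedMinors, Pi.smul_apply, smul_eq_mul]
    ring
  refine ⟨n, ?_, a, A, ha, ?_, ?_, gradeEq_minorsIdeal_two hA hexJ hJproj,
    (pdEq_quotient_two_iff _).2 ⟨hJ, hJproj⟩⟩
  · rw [Nat.one_le_iff_ne_zero]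
    rintro rfl
    have htop : minorsIdeal A = ⊤ :=
      (Ideal.eq_top_iff_one _).2 (Ideal.subset_span ⟨0, by simp⟩)
    exact hJproj (.of_equiv (Submodule.topEquiv.symm.trans (LinearEquiv.ofEq _ _ htop.symm)))
  · rw [hrow]
    refine ⟨hA, ?_, by rw [range_rowMap, hspan]⟩
    ext w
    rw [LinearMap.mem_ker, rowMap_apply]
    exact (hex w).symm
  · ext x
    rw [Ideal.mem_span_singleton_mul, ← hmap]
    rfl
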